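/- arXiv:1203.6664 — 8 statements merged into one kernel-verified Lean document; each statement's English description precedes it below -/
import Mathlib

section
/- Let G be a finite abelian group, H a subgroup of G, and let X₁ and X₂ be independent random variables on G with identical symmetric distributions. Then Pr[X₁ · X₂ ∈ H] ≥ |H|/|G|. -/
/-- The self-collision probability of `f` under a weight `p` of total mass one is at least the
reciprocal of the size of the codomain. -/
lemma one_le_card_mul_sum_sum_ite_eq {α β : Type*} [Fintype α] [Fintype β] [DecidableEq β]
    (f : α → β) (p : α → ℝ) (hp : ∑ a, p a = 1) :
    1 ≤ (Fintype.card β : ℝ) * ∑ a, ∑ b, if f a = f b then p a * p b else 0 := by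
  have hsq : ∑ a, ∑ b, (if f a = f b then p a * p b else 0)
      = ∑ y, (∑ a, if f a = y then p a else 0) ^ 2 := by
    simp_rw [sq, Finset.sum_mul_sum]
    rw [Finset.sum_comm (s := (Finset.univ : Finset β))]
    refine Finset.sum_congr rfl fun a _ => ?_
    rw [Finset.sum_comm]
    refine Finset.sum_congr rfl fun b _ => ?_
    simp [ite_mul, eq_comm]
  have htotal : ∑ y, ∑ a, (if f a = y then p a else 0) = 1 := by
    rw [Finset.sum_comm]
    simpa using hp
  have h := sq_sum_le_card_mul_sum_sq (s := (Finset.univ : Finset β))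
    (f := fun y => ∑ a, if f a = y then p a else 0)
  rw [htotal, ← hsq] at h
  simpa using h

/-- Let `G` be a finite abelian group, `H` a subgroup, and `X₁, X₂` independent
random variables on `G` with identical symmetric distribution `p`.  Then
`Pr[X₁ · X₂ ∈ H] = ∑_{a b, ab ∈ H} p a · p b ≥ |H| / |G|`. -/
theorem subgroup_collision_probability
    {G : Type*} [CommGroup G] [Fintype G] (H : Subgroup G) [DecidablePred (· ∈ H)]
    (p : G → ℝ) (hp0 : ∀ a, 0 ≤ p a) (hp1 : ∑ a, p a = 1)
    (hsym : ∀ a : G, p a = p a⁻¹) :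
    (∑ a : G, ∑ b : G, if a * b ∈ H then p a * p b else 0)
      ≥ (Nat.card H : ℝ) / Nat.card G := by
  classical
  have hcollision : (∑ a : G, ∑ b : G, if a * b ∈ H then p a * p b else 0)
      = ∑ a : G, ∑ b : G, if (a : G ⧸ H) = (b : G ⧸ H) then p a * p b else 0 := by
    rw [← Equiv.sum_comp (Equiv.inv G)]
    simp only [Equiv.inv_apply, ← hsym, QuotientGroup.eq]
  have h := one_le_card_mul_sum_sum_ite_eq (fun a : G => (a : G ⧸ H)) p hp1
  rw [← hcollision, ← Nat.card_eq_fintype_card] at h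
  have hG : (0 : ℝ) < Nat.card G := by exact_mod_cast Nat.card_pos
  rw [ge_iff_le, div_le_iff₀ hG, H.card_eq_card_quotient_mul_card_subgroup]
  push_cast
  nlinarith [mul_le_mul_of_nonneg_left h (Nat.cast_nonneg (α := ℝ) (Nat.card H))]
end

section
/- Let q₁ < q₂ < … denote the primes in increasing order, let r and m be integers with 10 < m ≤ r, and let h₁, …, h_r be integers with 1 ≤ h_i ≤ r/i for 1 ≤ i ≤ r. Then m < ∑_{i=1}^m h_i · log₂(q_i) < 2r·(log₂ m)². -/
open Real in
/-- For `m > 10` there are at least `m` primes up to `m ^ 2`. -/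
theorem le_primeCounting_sq {m : ℕ} (hm : 10 < m) : m ≤ Nat.primeCounting (m ^ 2) := by
  have hm' : (11 : ℝ) ≤ m := by exact_mod_cast hm
  have hpos : (0 : ℝ) < m := by linarith
  have hlog : 0 < log (m : ℝ) := log_pos (by linarith)
  have h2 := log_two_gt_d9
  have h2' := log_two_lt_d9
  have hsq : log ((m : ℝ) ^ 2) = 2 * log m := by rw [log_pow]; norm_num
  have h := Chebyshev.pi_ge (m ^ 2)
  push_cast at h
  rw [hsq] at h
  have h8 : log (m : ℝ) ≤ 3 * log 2 + (m / 8 - 1) := by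
    have h1 : log ((m : ℝ) / 8) ≤ m / 8 - 1 := log_le_sub_one_of_pos (by positivity)
    rw [log_div (by positivity) (by norm_num),
      show (8 : ℝ) = 2 ^ 3 by norm_num, log_pow] at h1
    norm_num at h1 ⊢
    linarith
  have hs : log ((m : ℝ) ^ 2 + 1) ≤ log 2 + 2 * log m := by
    rw [← hsq, ← log_mul (by norm_num) (by positivity)]
    exact log_le_log (by positivity) (by nlinarith)
  have key : (m : ℝ) ≤ ((m : ℝ) ^ 2 * log 2 - log ((m : ℝ) ^ 2 + 1)) / (2 * log m) := by
    rw [le_div_iff₀ (by positivity)]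
    have h3 : (m + 1) * log (m : ℝ) ≤ (m + 1) * (1.08 + m / 8) := by
      gcongr
      linarith
    have h4 : (m : ℝ) ^ 2 * 0.69 ≤ (m : ℝ) ^ 2 * log 2 := by
      gcongr
      linarith
    nlinarith
  exact_mod_cast key.trans h

/-- For `m > 10`, the `m`-th prime is at most `m ^ 2`. -/
theorem nth_prime_le_sq {m : ℕ} (hm : 10 < m) : Nat.nth Nat.Prime (m - 1) ≤ m ^ 2 := by
  have h := le_primeCounting_sq hm
  rw [Nat.primeCounting, Nat.primeCounting'] at h
  have hlt : m - 1 < Nat.count Nat.Prime (m ^ 2 + 1) := by omega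
  exact Nat.lt_succ_iff.mp (Nat.nth_lt_of_lt_count hlt)

open Real in
theorem one_add_log_lt_logb_two {m : ℕ} (hm : 10 < m) : 1 + log (m : ℝ) < logb 2 m := by
  have hm' : (11 : ℝ) ≤ m := by exact_mod_cast hm
  have h2 := log_two_gt_d9
  have h2' := log_two_lt_d9
  have h1 : 1 - ((m : ℝ) / 8)⁻¹ ≤ log ((m : ℝ) / 8) :=
    one_sub_inv_le_log_of_pos (by positivity)
  have h3 : ((m : ℝ) / 8)⁻¹ ≤ 8 / 11 := by
    rw [inv_div]
    gcongr
  rw [log_div (by positivity) (by norm_num),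
    show (8 : ℝ) = 2 ^ 3 by norm_num, log_pow] at h1
  norm_num at h1 h3
  rw [logb, lt_div_iff₀ (by linarith)]
  have h4 : (2.34 : ℝ) < log m := by linarith
  nlinarith

/-- Let `q_i` be the `i`-th prime, `10 < m ≤ r`, and `1 ≤ h_i ≤ r/i` for
`1 ≤ i ≤ r`.  Then `m < ∑_{i=1}^m h_i log₂ q_i < 2r (log₂ m)²`. -/
theorem sum_h_log_prime_bounds
    (r m : ℕ) (hm : 10 < m) (hmr : m ≤ r) (h : ℕ → ℕ)
    (hh : ∀ i ∈ Finset.Icc 1 r, 1 ≤ h i ∧ (h i : ℝ) ≤ (r : ℝ) / i) :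
    (m : ℝ) < ∑ i ∈ Finset.Icc 1 m, (h i : ℝ) * Real.logb 2 (Nat.nth Nat.Prime (i - 1)) ∧
    ∑ i ∈ Finset.Icc 1 m, (h i : ℝ) * Real.logb 2 (Nat.nth Nat.Prime (i - 1))
      < 2 * r * (Real.logb 2 m) ^ 2 := by
  have hsub : ∀ i ∈ Finset.Icc 1 m, 1 ≤ h i ∧ (h i : ℝ) ≤ (r : ℝ) / i := fun i hi =>
    hh i (Finset.Icc_subset_Icc_right hmr hi)
  have hprime : ∀ i, Nat.Prime (Nat.nth Nat.Prime i) := Nat.prime_nth_prime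
  have hlog : ∀ i, 1 ≤ Real.logb 2 (Nat.nth Nat.Prime i) := fun i => by
    rw [Real.le_logb_iff_rpow_le (by norm_num) (by exact_mod_cast (hprime i).pos)]
    rw [Real.rpow_one]
    exact_mod_cast (hprime i).two_le
  constructor
  · have hcard : (m : ℝ) = ∑ i ∈ Finset.Icc 1 m, (1 : ℝ) := by simp
    rw [hcard]
    refine Finset.sum_lt_sum (fun i hi => ?_) ⟨2, by simp; omega, ?_⟩
    · have h1 : (1 : ℝ) ≤ h i := by exact_mod_cast (hsub i hi).1
      exact one_le_mul_of_one_le_of_one_le h1 (hlog _)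
    · have h1 : (1 : ℝ) ≤ h 2 := by exact_mod_cast (hsub 2 (by simp; omega)).1
      refine one_lt_mul_of_le_of_lt h1 ?_
      rw [Real.lt_logb_iff_rpow_lt (by norm_num) (by exact_mod_cast (hprime _).pos),
        Real.rpow_one]
      have h0 : Nat.nth Nat.Prime 0 < Nat.nth Nat.Prime (2 - 1) :=
        Nat.nth_strictMono Nat.infinite_setOfPred_prime (by norm_num)
      exact_mod_cast (hprime 0).two_le.trans_lt h0
  · have hm' : (11 : ℝ) ≤ m := by exact_mod_cast hm
    have hr : (0 : ℝ) < r := by exact_mod_cast (by omega : 0 < r)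
    have hL : 0 < Real.logb 2 m := Real.logb_pos (by norm_num) (by linarith)
    have hterm : ∀ i ∈ Finset.Icc 1 m,
        (h i : ℝ) * Real.logb 2 (Nat.nth Nat.Prime (i - 1))
          ≤ 2 * r * Real.logb 2 m * (i : ℝ)⁻¹ := fun i hi => by
      have hq : Nat.nth Nat.Prime (i - 1) ≤ m ^ 2 :=
        (Nat.nth_monotone Nat.infinite_setOfPred_prime
          (Nat.sub_le_sub_right (Finset.mem_Icc.mp hi).2 1)).trans (nth_prime_le_sq hm)
      have hq' : Real.logb 2 (Nat.nth Nat.Prime (i - 1)) ≤ 2 * Real.logb 2 m := by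
        have hsq : Real.logb 2 ((m : ℝ) ^ 2) = 2 * Real.logb 2 m := by
          rw [Real.logb_pow]; norm_num
        rw [← hsq]
        exact Real.logb_le_logb_of_le (by norm_num)
          (by exact_mod_cast (hprime _).pos) (by exact_mod_cast hq)
      calc (h i : ℝ) * Real.logb 2 (Nat.nth Nat.Prime (i - 1))
          ≤ (r / i) * (2 * Real.logb 2 m) :=
            mul_le_mul (hsub i hi).2 hq' (zero_le_one.trans (hlog _)) (by positivity)
        _ = 2 * r * Real.logb 2 m * (i : ℝ)⁻¹ := by ring
    have hharm : ∑ i ∈ Finset.Icc 1 m, (i : ℝ)⁻¹ ≤ 1 + Real.log m := by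
      have := harmonic_le_one_add_log m
      rw [harmonic_eq_sum_Icc] at this
      push_cast at this
      exact this
    calc _ ≤ ∑ i ∈ Finset.Icc 1 m, 2 * r * Real.logb 2 m * (i : ℝ)⁻¹ := Finset.sum_le_sum hterm
      _ = 2 * r * Real.logb 2 m * ∑ i ∈ Finset.Icc 1 m, (i : ℝ)⁻¹ := by rw [Finset.mul_sum]
      _ < 2 * r * Real.logb 2 m * Real.logb 2 m :=
          mul_lt_mul_of_pos_left (hharm.trans_lt (one_add_log_lt_logb_two hm)) (by positivity)
      _ = 2 * r * (Real.logb 2 m) ^ 2 := by ring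
end

section
/- Let q₁ < q₂ < … denote the primes in increasing order, let r ≥ 11 be an integer, and let h₁, …, h_r be integers with 1 ≤ h_i ≤ r/i for 1 ≤ i ≤ r. Set Λ = ∏_{i=1}^r q_i^{h_i}. Then log₂ Λ < 2r·(log₂ r)². -/
/-- For `n ≥ 11`, the `n`-th prime (counting from one) is at most `n ^ 2`. -/
theorem nth_prime_pred_le_sq {n : ℕ} (hn : 11 ≤ n) : Nat.nth Nat.Prime (n - 1) ≤ n ^ 2 := by
  have hn' : (11 : ℝ) ≤ n := by exact_mod_cast hn
  have hpos : (0 : ℝ) < n := by linarith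
  have hl2 := Real.log_two_gt_d9
  have hl2' := Real.log_two_lt_d9
  have hlog : Real.log n ≤ n / 16 + 4 * Real.log 2 - 1 := by
    have h1 := Real.log_le_sub_one_of_pos (show (0 : ℝ) < n / 16 by positivity)
    rw [Real.log_div hpos.ne' (by norm_num), show (16 : ℝ) = 2 ^ 4 by norm_num,
      Real.log_pow] at h1
    push_cast at h1
    linarith
  have hlogpos : 0 < Real.log n := Real.log_pos (by linarith)
  have hsucc : Real.log ((n : ℝ) ^ 2 + 1) ≤ Real.log 2 + 2 * Real.log n := by
    have h1 : Real.log ((n : ℝ) ^ 2 + 1) ≤ Real.log (2 * (n : ℝ) ^ 2) :=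
      Real.log_le_log (by positivity) (by nlinarith)
    rwa [Real.log_mul (by norm_num) (by positivity), Real.log_pow, Nat.cast_ofNat] at h1
  have hpi := Chebyshev.pi_ge (n ^ 2)
  have hcount : (n : ℝ) ≤ Nat.primeCounting (n ^ 2) := by
    refine le_trans ?_ hpi
    push_cast
    rw [Real.log_pow, le_div_iff₀ (by positivity)]
    push_cast
    nlinarith [mul_le_mul_of_nonneg_left hlog hpos.le]
  have hlt : n - 1 < Nat.count Nat.Prime (n ^ 2 + 1) := by
    have h1 : n ≤ Nat.count Nat.Prime (n ^ 2 + 1) := by exact_mod_cast hcount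
    omega
  exact Nat.lt_succ_iff.mp (Nat.nth_lt_of_lt_count hlt)

theorem one_add_log_lt_logb_two_s8 {x : ℝ} (hx : 11 ≤ x) : 1 + Real.log x < Real.logb 2 x := by
  have hl2 := Real.log_two_gt_d9
  have hl2' := Real.log_two_lt_d9
  have h11 : 17 * Real.log 2 ≤ 5 * Real.log 11 := by
    have h1 : Real.log ((2 : ℝ) ^ 17) ≤ Real.log ((11 : ℝ) ^ 5) :=
      Real.log_le_log (by norm_num) (by norm_num)
    rw [Real.log_pow, Real.log_pow] at h1
    exact_mod_cast h1
  have hx' : Real.log 11 ≤ Real.log x := Real.log_le_log (by norm_num) hx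
  rw [Real.logb, lt_div_iff₀ (by linarith)]
  nlinarith

/-- Let `q_i` be the `i`-th prime, `r ≥ 11`, `1 ≤ h_i ≤ r/i` for `1 ≤ i ≤ r`, and
`Λ = ∏_{i=1}^r q_i^{h_i}`.  Then `log₂ Λ < 2r (log₂ r)²`. -/
theorem log_Lambda_bound
    (r : ℕ) (hr : 11 ≤ r) (h : ℕ → ℕ)
    (hh : ∀ i ∈ Finset.Icc 1 r, 1 ≤ h i ∧ (h i : ℝ) ≤ (r : ℝ) / i)
    (Λ : ℕ) (hΛ : Λ = ∏ i ∈ Finset.Icc 1 r, (Nat.nth Nat.Prime (i - 1)) ^ h i) :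
    Real.logb 2 Λ < 2 * r * (Real.logb 2 r) ^ 2 := by
  have hr' : (11 : ℝ) ≤ r := by exact_mod_cast hr
  have hL : 0 < Real.logb 2 r := Real.logb_pos (by norm_num) (by linarith)
  have hprime (i : ℕ) : (Nat.nth Nat.Prime i).Prime := Nat.prime_nth_prime i
  have hterm : ∀ i ∈ Finset.Icc 1 r,
      Real.logb 2 ((Nat.nth Nat.Prime (i - 1) : ℝ) ^ h i) ≤
        2 * r * Real.logb 2 r * (i : ℝ)⁻¹ := by
    intro i hi
    have hir := (Finset.mem_Icc.mp hi).2
    have hq : (Nat.nth Nat.Prime (i - 1) : ℝ) ≤ (r : ℝ) ^ 2 := by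
      exact_mod_cast (Nat.nth_monotone Nat.infinite_setOfPred_prime (by omega)).trans
        (nth_prime_pred_le_sq hr)
    have hq0 : (0 : ℝ) < Nat.nth Nat.Prime (i - 1) := by exact_mod_cast (hprime _).pos
    have hlog : Real.logb 2 (Nat.nth Nat.Prime (i - 1)) ≤ 2 * Real.logb 2 r := by
      have h1 := Real.logb_le_logb_of_le (b := 2) (by norm_num) hq0 hq
      rwa [Real.logb_pow, Nat.cast_ofNat] at h1
    rw [Real.logb_pow]
    calc (h i : ℝ) * Real.logb 2 (Nat.nth Nat.Prime (i - 1))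
        ≤ h i * (2 * Real.logb 2 r) := by gcongr
      _ ≤ r / i * (2 * Real.logb 2 r) := by gcongr; exact (hh i hi).2
      _ = 2 * r * Real.logb 2 r * (i : ℝ)⁻¹ := by ring
  have hharm : ∑ i ∈ Finset.Icc 1 r, (i : ℝ)⁻¹ ≤ 1 + Real.log r := by
    have h1 := harmonic_le_one_add_log r
    rw [harmonic_eq_sum_Icc] at h1
    simpa using h1
  rw [hΛ]
  push_cast
  rw [Real.logb_prod _ _ fun i _ => pow_ne_zero _ (by exact_mod_cast (hprime _).ne_zero)]
  calc _ ≤ ∑ i ∈ Finset.Icc 1 r, 2 * r * Real.logb 2 r * (i : ℝ)⁻¹ := Finset.sum_le_sum hterm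
    _ = 2 * r * Real.logb 2 r * ∑ i ∈ Finset.Icc 1 r, (i : ℝ)⁻¹ := by rw [Finset.mul_sum]
    _ ≤ 2 * r * Real.logb 2 r * (1 + Real.log r) := by gcongr
    _ < 2 * r * Real.logb 2 r * Real.logb 2 r := by
      gcongr
      exact one_add_log_lt_logb_two_s8 hr'
    _ = 2 * r * (Real.logb 2 r) ^ 2 := by ring
end

section
/- Let q₁ < q₂ < … denote the primes in increasing order, let r ≥ 64 be an integer, let h₁, …, h_r be integers with 1 ≤ h_i ≤ r/i for 1 ≤ i ≤ r, and set Λ = ∏_{i=1}^r q_i^{h_i}. Define the real number N = (Λ / (φ(Λ) · ln√(2Λ))) · ∏_{i=1}^r (h_i + (q_i − 2)/(q_i − 1)), where φ is Euler's totient function and ln is the natural logarithm. Then log₂ N > r/3. -/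
theorem nth_prime_le_two_pow (k : ℕ) : Nat.nth Nat.Prime k ≤ 2 ^ (k + 1) := by
  induction k with
  | zero => simp [Nat.nth_prime_zero_eq_two]
  | succ k ih =>
    obtain ⟨p, hp, hlt, hle⟩ := Nat.exists_prime_lt_and_le_two_mul (Nat.nth Nat.Prime k)
      (Nat.prime_nth_prime k).ne_zero
    have hnext : Nat.nth Nat.Prime (k + 1) ≤ p := by
      by_contra! hcon
      exact absurd hlt (Nat.le_nth_of_lt_nth_succ hcon hp).not_gt
    rw [pow_succ]
    omega

theorem totient_prod_of_pairwise_coprime {ι : Type*} (s : Finset ι) (f : ι → ℕ)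
    (hf : (s : Set ι).Pairwise fun i j => (f i).Coprime (f j)) :
    Nat.totient (∏ i ∈ s, f i) = ∏ i ∈ s, Nat.totient (f i) := by
  classical
  induction s using Finset.induction_on with
  | empty => simp
  | insert a s ha ih =>
    rw [Finset.prod_insert ha, Finset.prod_insert ha, Nat.totient_mul, ih]
    · exact hf.mono (by simp)
    · refine Nat.Coprime.prod_right fun i hi => hf (by simp) (by simp [hi]) ?_
      rintro rfl
      exact ha hi

theorem two_le_prime_pow_factor {p k : ℕ} (hp : p.Prime) (hk : 1 ≤ k) :
    (2 : ℝ) ≤ ((p ^ k : ℕ) : ℝ) / (Nat.totient (p ^ k) : ℝ)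
      * ((k : ℝ) + ((p : ℝ) - 2) / ((p : ℝ) - 1)) := by
  obtain ⟨m, rfl⟩ : ∃ m, k = m + 1 := ⟨k - 1, by omega⟩
  have hp2 : (2 : ℝ) ≤ p := by exact_mod_cast hp.two_le
  have hp1 : (0 : ℝ) < (p : ℝ) - 1 := by linarith
  have hp0 : (p : ℝ) ≠ 0 := by positivity
  rw [Nat.totient_prime_pow_succ hp, Nat.cast_mul, Nat.cast_sub hp.one_le, pow_succ]
  push_cast
  rw [mul_div_mul_left _ _ (pow_ne_zero m hp0)]
  have hbase : (2 : ℝ) ≤ (p : ℝ) / ((p : ℝ) - 1) * (1 + ((p : ℝ) - 2) / ((p : ℝ) - 1)) := by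
    have hrw : (p : ℝ) / ((p : ℝ) - 1) * (1 + ((p : ℝ) - 2) / ((p : ℝ) - 1))
        = (p * (2 * p - 3)) / ((p : ℝ) - 1) ^ 2 := by
      field_simp
      ring
    rw [hrw, le_div_iff₀ (by positivity)]
    nlinarith
  refine hbase.trans ?_
  gcongr
  have : (0 : ℝ) ≤ m := by positivity
  linarith

theorem pow_three_lt_two_pow {n : ℕ} (hn : 10 ≤ n) : n ^ 3 < 2 ^ n := by
  induction n, hn using Nat.le_induction with
  | base => norm_num
  | succ n hn ih =>
    rw [pow_succ 2 n]
    nlinarith [Nat.mul_le_mul hn hn, Nat.mul_le_mul (Nat.mul_le_mul hn hn) hn,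
      Nat.mul_le_mul_right (n * n) hn]

/-- Let `q_i` be the `i`-th prime, `r ≥ 64`, `1 ≤ h_i ≤ r/i`,
`Λ = ∏_{i=1}^r q_i^{h_i}` and
`N = (Λ/(φ(Λ)·ln √(2Λ))) · ∏_{i=1}^r (h_i + (q_i−2)/(q_i−1))`.
Then `log₂ N > r/3`. -/
theorem log_N_bound
    (r : ℕ) (hr : 64 ≤ r) (h : ℕ → ℕ)
    (hh : ∀ i ∈ Finset.Icc 1 r, 1 ≤ h i ∧ (h i : ℝ) ≤ (r : ℝ) / i)
    (Λ : ℕ) (hΛ : Λ = ∏ i ∈ Finset.Icc 1 r, (Nat.nth Nat.Prime (i - 1)) ^ h i)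
    (N : ℝ)
    (hN : N = (Λ : ℝ) / ((Nat.totient Λ : ℝ) * Real.log (Real.sqrt (2 * Λ)))
        * ∏ i ∈ Finset.Icc 1 r,
            ((h i : ℝ) + ((Nat.nth Nat.Prime (i - 1) : ℝ) - 2)
              / ((Nat.nth Nat.Prime (i - 1) : ℝ) - 1))) :
    Real.logb 2 N > (r : ℝ) / 3 := by
  set q : ℕ → ℕ := fun i => Nat.nth Nat.Prime (i - 1)
  have hprime (i : ℕ) : (q i).Prime := Nat.prime_nth_prime _
  have hr0 : (0 : ℝ) < r := by exact_mod_cast (by omega : 0 < r)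
  have hcop : ((Finset.Icc 1 r : Finset ℕ) : Set ℕ).Pairwise
      fun i j => (q i ^ h i).Coprime (q j ^ h j) := by
    intro i hi j hj hij
    rw [Finset.mem_coe, Finset.mem_Icc] at hi hj
    refine Nat.Coprime.pow _ _ ((Nat.coprime_primes (hprime i) (hprime j)).2 fun heq => hij ?_)
    have := Nat.nth_injective Nat.infinite_setOfPred_prime heq
    omega
  have hΛpos : 0 < Λ := by
    rw [hΛ]
    exact Finset.prod_pos fun i _ => pow_pos (hprime i).pos _
  have hΛ1 : (1 : ℝ) ≤ Λ := by exact_mod_cast hΛpos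
  set L : ℝ := Real.log (Real.sqrt (2 * Λ)) with hL
  have hLeq : L = (Real.log 2 + Real.log Λ) / 2 := by
    rw [hL, Real.log_sqrt (by positivity), Real.log_mul (by norm_num) (by positivity)]
  have hlog2 : 0 < Real.log 2 := Real.log_pos (by norm_num)
  have hlog2' : Real.log 2 < 1 := by linarith [Real.log_two_lt_d9]
  have hLpos : 0 < L := by
    rw [hLeq]
    linarith [Real.log_nonneg hΛ1]
  have hlogΛ : Real.log Λ ≤ r ^ 2 * Real.log 2 := by
    rw [hΛ, Nat.cast_prod, Real.log_prod fun i _ => by exact_mod_cast (pow_pos (hprime i).pos _).ne']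
    calc ∑ i ∈ Finset.Icc 1 r, Real.log ((q i ^ h i : ℕ) : ℝ)
        ≤ ∑ i ∈ Finset.Icc 1 r, r * Real.log 2 := by
          refine Finset.sum_le_sum fun i hi => ?_
          have hi0 : (0 : ℝ) < i := by exact_mod_cast (Finset.mem_Icc.1 hi).1
          have hqi : Real.log (q i) ≤ i * Real.log 2 := by
            rw [← Real.log_pow]
            refine Real.log_le_log (by exact_mod_cast (hprime i).pos) ?_
            have := nth_prime_le_two_pow (i - 1)
            rw [Nat.sub_add_cancel (Finset.mem_Icc.1 hi).1] at this
            exact_mod_cast this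
          rw [Nat.cast_pow, Real.log_pow]
          calc (h i : ℝ) * Real.log (q i) ≤ r / i * (i * Real.log 2) :=
                mul_le_mul (hh i hi).2 hqi (Real.log_natCast_nonneg _) (by positivity)
            _ = r * Real.log 2 := by field_simp
      _ = r ^ 2 * Real.log 2 := by simp; ring
  have hLle : L ≤ (r : ℝ) ^ 2 := by
    have : (1 : ℝ) ≤ r := by exact_mod_cast (by omega : 1 ≤ r)
    rw [hLeq]
    nlinarith
  have hprod : (2 : ℝ) ^ r / L ≤ N := by
    have hN' : N = (∏ i ∈ Finset.Icc 1 r, (((q i ^ h i : ℕ) : ℝ) / (Nat.totient (q i ^ h i) : ℝ)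
        * ((h i : ℝ) + ((q i : ℝ) - 2) / ((q i : ℝ) - 1)))) / L := by
      rw [Finset.prod_mul_distrib, Finset.prod_div_distrib, ← Nat.cast_prod, ← Nat.cast_prod,
        ← totient_prod_of_pairwise_coprime _ _ hcop, ← hΛ, hN]
      ring
    rw [hN']
    gcongr
    calc (2 : ℝ) ^ r = ∏ i ∈ Finset.Icc 1 r, (2 : ℝ) := by simp
      _ ≤ _ := Finset.prod_le_prod (fun _ _ => by norm_num)
          fun i hi => two_le_prime_pow_factor (hprime i) (hh i hi).1
  have hcube : 3 * Real.logb 2 r < r := by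
    have hlt : ((r : ℝ) ^ 3) < 2 ^ r := by
      exact_mod_cast pow_three_lt_two_pow (by omega : 10 ≤ r)
    have := Real.logb_lt_logb (by norm_num : (1 : ℝ) < 2) (by positivity) hlt
    simpa [Real.logb_pow] using this
  have hlogL : Real.logb 2 L ≤ 2 * Real.logb 2 r := by
    have := Real.logb_le_logb_of_le (by norm_num : (1 : ℝ) < 2) hLpos hLle
    simpa [Real.logb_pow] using this
  have hlogN := Real.logb_le_logb_of_le (by norm_num : (1 : ℝ) < 2) (by positivity) hprod
  rw [Real.logb_div (by positivity) hLpos.ne', Real.logb_pow,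
    Real.logb_self_eq_one (by norm_num), mul_one] at hlogN
  linarith
end

section
/- Let q₁ < q₂ < … denote the primes in increasing order, let r ≥ 16 and m ≥ 1 be integers, and let h_{m+1}, …, h_r be integers with h_j ≥ 1. Then ∏_{j=m+1}^r (h_j + 1)/(h_j + (q_j − 2)/(q_j − 1)) < (ln r)². -/
/-- There are at most `2 ^ (k + 1) / k` primes in the dyadic block `(2 ^ k, 2 ^ (k + 1)]`. -/
lemma mul_card_primes_dyadic_le (k : ℕ) :
    k * ((Finset.Ioc (2 ^ k) (2 ^ (k + 1))).filter Nat.Prime).card ≤ 2 ^ (k + 1) := by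
  set s := (Finset.Ioc (2 ^ k) (2 ^ (k + 1))).filter Nat.Prime with hs
  have hdvd : ∏ p ∈ s, p ∣ (2 ^ k + 2 ^ k).choose (2 ^ k) := by
    refine Finset.prod_primes_dvd _ (fun p hp => ?_) (fun p hp => ?_)
    · exact (Finset.mem_filter.1 hp).2.prime
    · simp only [hs, Finset.mem_filter, Finset.mem_Ioc] at hp
      exact hp.2.dvd_choose_add hp.1.1 hp.1.1 (by rw [← two_mul, ← pow_succ']; exact hp.1.2)
  have hlow : (2 ^ k) ^ s.card ≤ ∏ p ∈ s, p := by
    refine Finset.pow_card_le_prod _ _ _ fun p hp => ?_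
    simp only [hs, Finset.mem_filter, Finset.mem_Ioc] at hp
    exact hp.1.1.le
  have hpow : 2 ^ (k * s.card) ≤ 2 ^ (2 ^ (k + 1)) := calc
    2 ^ (k * s.card) = (2 ^ k) ^ s.card := pow_mul _ _ _
    _ ≤ ∏ p ∈ s, p := hlow
    _ ≤ (2 ^ k + 2 ^ k).choose (2 ^ k) :=
      Nat.le_of_dvd (Nat.choose_pos (Nat.le_add_right _ _)) hdvd
    _ ≤ 2 ^ (2 ^ k + 2 ^ k) := Nat.choose_le_two_pow _ _
    _ = 2 ^ (2 ^ (k + 1)) := by rw [← two_mul, ← pow_succ']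
  exact (Nat.pow_le_pow_iff_right (by norm_num)).1 hpow

/-- An exponential bound for a product of factors `1 + 1 / (2 p - 3)` over integers exceeding `N`. -/
lemma prod_one_add_le_exp (s : Finset ℕ) (N : ℕ) (hN : 1 ≤ N) (hs : ∀ p ∈ s, N < p) :
    ∏ p ∈ s, (1 + 1 / (2 * (p : ℝ) - 3)) ≤ Real.exp (s.card / (2 * N - 1)) := by
  have hN' : (1 : ℝ) ≤ N := by exact_mod_cast hN
  calc ∏ p ∈ s, (1 + 1 / (2 * (p : ℝ) - 3))
      ≤ ∏ p ∈ s, Real.exp (1 / (2 * N - 1)) := by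
        have hp' (p) (hp : p ∈ s) : (N : ℝ) + 1 ≤ p := by exact_mod_cast hs p hp
        refine Finset.prod_le_prod (fun p hp => ?_) (fun p hp => ?_)
        · have : (0 : ℝ) < 2 * p - 3 := by linarith [hp' p hp]
          positivity
        · have : 1 / (2 * (p : ℝ) - 3) ≤ 1 / (2 * N - 1) :=
            one_div_le_one_div_of_le (by linarith) (by linarith [hp' p hp])
          linarith [Real.add_one_le_exp (1 / (2 * (N : ℝ) - 1))]
    _ = Real.exp (s.card / (2 * N - 1)) := by
        rw [Finset.prod_const, ← Real.exp_nat_mul, mul_one_div]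

lemma prod_odd_primes_le (k : ℕ) (hk : 4 ≤ k) :
    ∏ p ∈ (Finset.Ioc 2 (2 ^ k)).filter Nat.Prime, (1 + 1 / (2 * (p : ℝ) - 3)) ≤ k - 2 := by
  induction k, hk using Nat.le_induction with
  | base =>
    have : (Finset.Ioc 2 (2 ^ 4)).filter Nat.Prime = {3, 5, 7, 11, 13} := by decide
    rw [this]
    norm_num
  | succ k hk ih =>
    have h2 : 2 ≤ 2 ^ k := Nat.le_self_pow (by omega) 2
    have hk' : (4 : ℝ) ≤ k := by exact_mod_cast hk
    have hpow : (k : ℝ) ≤ 2 ^ (k + 1) := by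
      exact_mod_cast Nat.lt_two_pow_self.le.trans
        (Nat.pow_le_pow_right (by norm_num) k.le_succ)
    rw [← Finset.Ioc_union_Ioc_eq_Ioc h2 (Nat.pow_le_pow_right (by norm_num) k.le_succ),
      Finset.filter_union, Finset.prod_union (Finset.disjoint_filter_filter
        (Finset.disjoint_left.2 fun p hp hp' => by
          rw [Finset.mem_Ioc] at hp hp'; omega))]
    set s := (Finset.Ioc (2 ^ k) (2 ^ (k + 1))).filter Nat.Prime with hs
    have hblock := prod_one_add_le_exp s (2 ^ k) (by omega)
      (fun p hp => (Finset.mem_Ioc.1 (Finset.mem_filter.1 hp).1).1)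
    have hcard : (k : ℝ) * s.card ≤ 2 ^ (k + 1) := by
      exact_mod_cast mul_card_primes_dyadic_le k
    have hx : (s.card : ℝ) / (2 * (2 ^ k : ℕ) - 1) ≤ 1 / (k - 1) := by
      push_cast
      rw [← pow_succ', div_le_div_iff₀ (by linarith) (by linarith)]
      have : (k : ℝ) * (s.card * (k - 1)) ≤ k * (1 * (2 ^ (k + 1) - 1)) := by nlinarith
      exact le_of_mul_le_mul_left this (by linarith)
    have hexp : Real.exp (1 / ((k : ℝ) - 1)) ≤ (k - 1) / (k - 2) := by
      have h1 := Real.one_sub_le_exp_neg (1 / ((k : ℝ) - 1))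
      rw [Real.exp_neg] at h1
      have h3 : 1 - 1 / ((k : ℝ) - 1) = (((k : ℝ) - 1) / (k - 2))⁻¹ := by
        have : (k : ℝ) - 1 ≠ 0 := by linarith
        have : (k : ℝ) - 2 ≠ 0 := by linarith
        field_simp
        ring
      rw [h3] at h1
      exact (inv_le_inv₀ (div_pos (by linarith) (by linarith)) (Real.exp_pos _)).1 h1
    calc _ ≤ ((k : ℝ) - 2) * ((k - 1) / (k - 2)) :=
          mul_le_mul ih (hblock.trans ((Real.exp_le_exp.2 hx).trans hexp))
            (Finset.prod_nonneg fun p hp => by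
              have hp1 := (Finset.mem_Ioc.1 (Finset.mem_filter.1 hp).1).1
              have hp2 : (2 : ℝ) < p := by exact_mod_cast h2.trans_lt hp1
              have : (0 : ℝ) < 2 * p - 3 := by linarith
              positivity) (by linarith)
      _ = ((k + 1 : ℕ) : ℝ) - 2 := by
          have : (k : ℝ) - 2 ≠ 0 := by linarith
          field_simp
          push_cast
          ring

lemma div_le_one_add_one_div {a q : ℝ} (ha : 1 ≤ a) (hq : 2 < q) :
    (a + 1) / (a + (q - 2) / (q - 1)) ≤ 1 + 1 / (2 * q - 3) := by
  have h1 : 0 < q - 1 := by linarith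
  have h3 : 0 < 2 * q - 3 := by linarith
  have h2 : 0 ≤ (q - 2) / (q - 1) := div_nonneg (by linarith) h1.le
  rw [div_le_iff₀ (by linarith), ← sub_nonneg]
  have : (1 + 1 / (2 * q - 3)) * (a + (q - 2) / (q - 1)) - (a + 1) = (a - 1) / (2 * q - 3) := by
    field_simp
    ring
  rw [this]
  exact div_nonneg (by linarith) h3.le

lemma prod_filter_primes_le (r k : ℕ) (s : Finset ℕ) (hk : 4 ≤ k) (hr : r < 2 ^ (k + 1))
    (hcard : s.card + 1 ≤ r) (hs : ∀ p ∈ s, p.Prime ∧ 2 < p) :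
    ∏ p ∈ s, (1 + 1 / (2 * (p : ℝ) - 3)) ≤ (k - 2) * Real.exp 1 := by
  have hone (p : ℕ) (hp : 2 < p) : 1 ≤ 1 + 1 / (2 * (p : ℝ) - 3) := by
    have hp' : (2 : ℝ) < p := by exact_mod_cast hp
    have : (0 : ℝ) < 2 * p - 3 := by linarith
    exact le_add_of_nonneg_right (by positivity)
  have hk' : (4 : ℝ) ≤ k := by exact_mod_cast hk
  rw [← Finset.prod_filter_mul_prod_filter_not s (· ≤ 2 ^ k)]
  refine mul_le_mul ?_ ?_ (Finset.prod_nonneg fun p hp => zero_le_one.trans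
    (hone p (hs p (Finset.mem_filter.1 hp).1).2)) (by linarith)
  · refine le_trans (Finset.prod_le_prod_of_subset_of_one_le ?_ ?_ ?_) (prod_odd_primes_le k hk)
    · intro p hp
      rw [Finset.mem_filter] at hp
      rw [Finset.mem_filter, Finset.mem_Ioc]
      exact ⟨⟨(hs p hp.1).2, hp.2⟩, (hs p hp.1).1⟩
    · intro p hp
      exact zero_le_one.trans (hone p (hs p (Finset.mem_filter.1 hp).1).2)
    · intro p hp _
      exact hone p (Finset.mem_Ioc.1 (Finset.mem_filter.1 hp).1).1
  · have hN : 1 ≤ 2 ^ k := Nat.one_le_two_pow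
    refine (prod_one_add_le_exp _ (2 ^ k) hN fun p hp =>
      not_le.1 (Finset.mem_filter.1 hp).2).trans (Real.exp_le_exp.2 ?_)
    have hN' : (1 : ℝ) ≤ (2 ^ k : ℕ) := by exact_mod_cast hN
    rw [div_le_one (by linarith)]
    have hle := Finset.card_filter_le s (fun p => ¬ p ≤ 2 ^ k)
    have : (s.filter (fun p => ¬ p ≤ 2 ^ k)).card + 1 ≤ 2 * 2 ^ k := by rw [← pow_succ']; omega
    have h' : ((s.filter (fun p => ¬ p ≤ 2 ^ k)).card : ℝ) + 1 ≤ 2 * (2 ^ k : ℕ) := by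
      exact_mod_cast this
    linarith

/-- Let `q_j` be the `j`-th prime, `r ≥ 16`, `m ≥ 1`, and `h_j ≥ 1` for
`m+1 ≤ j ≤ r`.  Then `∏_{j=m+1}^r (h_j+1)/(h_j + (q_j−2)/(q_j−1)) < (ln r)²`. -/
theorem correction_term_bound
    (r m : ℕ) (hr : 16 ≤ r) (hm : 1 ≤ m) (h : ℕ → ℕ)
    (hh : ∀ j ∈ Finset.Icc (m + 1) r, 1 ≤ h j) :
    ∏ j ∈ Finset.Icc (m + 1) r,
        ((h j : ℝ) + 1)
          / ((h j : ℝ) + ((Nat.nth Nat.Prime (j - 1) : ℝ) - 2)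
              / ((Nat.nth Nat.Prime (j - 1) : ℝ) - 1))
      < (Real.log r) ^ 2 := by
  have hq (j) (hj : j ∈ Finset.Icc (m + 1) r) : 2 < Nat.nth Nat.Prime (j - 1) := by
    rw [Finset.mem_Icc] at hj
    rw [← Nat.nth_prime_zero_eq_two]
    exact Nat.nth_strictMono Nat.infinite_setOfPred_prime (by omega)
  have hinj : Set.InjOn (fun j => Nat.nth Nat.Prime (j - 1)) (Finset.Icc (m + 1) r) := by
    intro i hi j hj hij
    have := Nat.nth_injective Nat.infinite_setOfPred_prime hij
    rw [Finset.mem_coe, Finset.mem_Icc] at hi hj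
    omega
  set s := (Finset.Icc (m + 1) r).image (fun j => Nat.nth Nat.Prime (j - 1)) with hs
  have hcard : s.card + 1 ≤ r := by
    have : s.card ≤ (Finset.Icc (m + 1) r).card := Finset.card_image_le
    rw [Nat.card_Icc] at this
    omega
  have hsp : ∀ p ∈ s, p.Prime ∧ 2 < p := by
    intro p hp
    obtain ⟨j, hj, rfl⟩ := Finset.mem_image.1 hp
    exact ⟨Nat.prime_nth_prime _, hq j hj⟩
  set k := Nat.log 2 r
  have hk : 4 ≤ k := Nat.le_log_of_pow_le (by norm_num) hr
  have hk' : (4 : ℝ) ≤ k := by exact_mod_cast hk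
  have hrk : r < 2 ^ (k + 1) := Nat.lt_pow_succ_log_self (by norm_num) r
  have hkr : 2 ^ k ≤ r := Nat.pow_log_le_self 2 (by omega)
  have hlog : (k : ℝ) * Real.log 2 ≤ Real.log r := by
    rw [← Real.log_pow]
    exact Real.log_le_log (by positivity) (by exact_mod_cast hkr)
  calc _ ≤ ∏ j ∈ Finset.Icc (m + 1) r, (1 + 1 / (2 * (Nat.nth Nat.Prime (j - 1) : ℝ) - 3)) := by
        refine Finset.prod_le_prod (fun j hj => ?_) (fun j hj => ?_)
        · have : (2 : ℝ) < Nat.nth Nat.Prime (j - 1) := by exact_mod_cast hq j hj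
          have h1 : (0 : ℝ) < (Nat.nth Nat.Prime (j - 1) : ℝ) - 1 := by linarith
          have h2 : (0 : ℝ) < (Nat.nth Nat.Prime (j - 1) : ℝ) - 2 := by linarith
          positivity
        · exact div_le_one_add_one_div (by exact_mod_cast hh j hj) (by exact_mod_cast hq j hj)
    _ = ∏ p ∈ s, (1 + 1 / (2 * (p : ℝ) - 3)) := by rw [hs, Finset.prod_image hinj]
    _ ≤ (k - 2) * Real.exp 1 := prod_filter_primes_le r k s hk hrk hcard hsp
    _ ≤ (k - 2) * 2.72 := by
        have := Real.exp_one_lt_d9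
        exact mul_le_mul_of_nonneg_left (by linarith) (by linarith)
    _ < (k * 0.69) ^ 2 := by nlinarith [sq_nonneg ((k : ℝ) - 3)]
    _ ≤ (Real.log r) ^ 2 := by
        have := Real.log_two_gt_d9
        refine pow_le_pow_left₀ (by positivity) (le_trans ?_ hlog) 2
        exact mul_le_mul_of_nonneg_left (by linarith) (by linarith)
end

section
/- There exists a constant R such that the following holds for all integers r ≥ R. Let q₁ < q₂ < … denote the primes in increasing order, let h₁, …, h_r be integers with 1 ≤ h_i ≤ r/i, set Λ = ∏_{i=1}^r q_i^{h_i}, and let N = (Λ / (φ(Λ) · ln√(2Λ))) · ∏_{i=1}^r (h_i + (q_i − 2)/(q_i − 1)). Suppose m is an integer with 10 < m ≤ r that is minimal with the property that N · ∏_{i=m+1}^r 1/(h_i + 1) > (log₂ Λ) · 4^{√(∑_{i=1}^m h_i log₂ q_i)}. Then ∑_{i=1}^m h_i · log₂(q_i) < 27 · (log₂ N) · (log₂ log₂ N)². -/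
/-- Chebyshev's lower bound for the prime counting function gives `q_i ≤ n ^ 2` for `i ≤ n`. -/
lemma nth_prime_le_sq_s11 {n : ℕ} (hn : 2 ≤ n) (hlog : Real.log n ≤ n / 100) {i : ℕ} (hi : i < n) :
    Nat.nth Nat.Prime i ≤ n ^ 2 := by
  have hn' : (2 : ℝ) ≤ n := by exact_mod_cast hn
  have hpos : 0 < Real.log n := Real.log_pos (by linarith)
  have hcheb := Chebyshev.pi_ge (n ^ 2)
  push_cast at hcheb
  have hsucc : Real.log ((n : ℝ) ^ 2 + 1) ≤ Real.log 2 + 2 * Real.log n := by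
    calc Real.log ((n : ℝ) ^ 2 + 1) ≤ Real.log (2 * (n : ℝ) ^ 2) :=
          Real.log_le_log (by positivity) (by nlinarith)
      _ = Real.log 2 + 2 * Real.log n := by
          rw [Real.log_mul (by norm_num) (by positivity), Real.log_pow]; norm_num
  have hcount : (n : ℝ) ≤ Nat.primeCounting (n ^ 2) := by
    refine le_trans ?_ hcheb
    rw [Real.log_pow, le_div_iff₀ (by positivity)]
    push_cast
    have h1 := mul_le_mul_of_nonneg_left hlog (by linarith : (0 : ℝ) ≤ n)
    have h2 := mul_le_mul_of_nonneg_left Real.log_two_gt_d9.le (sq_nonneg (n : ℝ))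
    nlinarith [Real.log_two_lt_d9]
  have hcount' : n ≤ Nat.primeCounting (n ^ 2) := by exact_mod_cast hcount
  exact Nat.lt_succ_iff.mp (Nat.nth_lt_of_lt_count (hi.trans_le hcount'))

lemma sum_Icc_inv_le_one_add_log (n : ℕ) :
    ∑ i ∈ Finset.Icc 1 n, (1 : ℝ) / i ≤ 1 + Real.log n := by
  have := harmonic_le_one_add_log n
  rw [harmonic_eq_sum_Icc] at this
  push_cast at this
  simpa only [one_div] using this

lemma three_halves_pow_le_prod {r : ℕ} (hr : 1 ≤ r) {h : ℕ → ℕ}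
    (hh : ∀ i ∈ Finset.Icc 1 r, 1 ≤ h i) :
    (3 / 2 : ℝ) ^ (r - 1) ≤ ∏ i ∈ Finset.Icc 1 r,
      ((h i : ℝ) + ((Nat.nth Nat.Prime (i - 1) : ℝ) - 2)
        / ((Nat.nth Nat.Prime (i - 1) : ℝ) - 1)) := by
  rw [← Finset.mul_prod_Ioc_eq_prod_Icc hr]
  have hfirst : (1 : ℝ) ≤ (h 1 : ℝ) + ((Nat.nth Nat.Prime (1 - 1) : ℝ) - 2)
        / ((Nat.nth Nat.Prime (1 - 1) : ℝ) - 1) := by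
    have h1 : 1 ≤ h 1 := hh 1 (by simp [hr])
    simpa [Nat.nth_prime_zero_eq_two] using h1
  have hrest : (3 / 2 : ℝ) ^ (r - 1) ≤ ∏ i ∈ Finset.Ioc 1 r,
      ((h i : ℝ) + ((Nat.nth Nat.Prime (i - 1) : ℝ) - 2)
        / ((Nat.nth Nat.Prime (i - 1) : ℝ) - 1)) := by
    calc (3 / 2 : ℝ) ^ (r - 1) = ∏ i ∈ Finset.Ioc 1 r, (3 / 2 : ℝ) := by
          rw [Finset.prod_const, Nat.card_Ioc]
      _ ≤ _ := by
        refine Finset.prod_le_prod (fun _ _ => by norm_num) fun i hi => ?_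
        rw [Finset.mem_Ioc] at hi
        have hhi : (1 : ℝ) ≤ h i := by
          exact_mod_cast hh i (Finset.mem_Icc.mpr ⟨hi.1.le, hi.2⟩)
        have hq : 3 ≤ Nat.nth Nat.Prime (i - 1) := by
          rw [← Nat.nth_prime_one_eq_three]
          exact Nat.nth_monotone Nat.infinite_setOfPred_prime (by omega)
        have hq' : (3 : ℝ) ≤ Nat.nth Nat.Prime (i - 1) := by exact_mod_cast hq
        have : (1 / 2 : ℝ) ≤ ((Nat.nth Nat.Prime (i - 1) : ℝ) - 2)
            / ((Nat.nth Nat.Prime (i - 1) : ℝ) - 1) := by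
          rw [le_div_iff₀ (by linarith)]; linarith
        linarith
  nlinarith [pow_pos (by norm_num : (0 : ℝ) < 3 / 2) (r - 1)]

lemma half_le_logb_three_halves_pow {r : ℕ} (hr : 1 ≤ r) :
    ((r : ℝ) - 1) / 2 ≤ Real.logb 2 ((3 / 2 : ℝ) ^ (r - 1)) := by
  have hbase : (1 / 2 : ℝ) ≤ Real.logb 2 (3 / 2) := by
    have h1 : (1 : ℝ) ≤ Real.logb 2 ((3 / 2) ^ 2) := by
      rw [Real.le_logb_iff_rpow_le (by norm_num) (by norm_num)]; norm_num
    rw [Real.logb_pow] at h1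
    push_cast at h1
    linarith
  rw [Real.logb_pow, Nat.cast_sub hr]
  push_cast
  have hr' : (1 : ℝ) ≤ r := by exact_mod_cast hr
  nlinarith

/-- Prime powers with bounded bases and exponents have a product whose logarithm is small. -/
lemma log_sqrt_two_mul_prod_le {r : ℕ} (hr : 2 ≤ r) {q h : ℕ → ℕ}
    (hq0 : ∀ i ∈ Finset.Icc 1 r, 0 < q i) (hq : ∀ i ∈ Finset.Icc 1 r, q i ≤ r ^ 2)
    (hh : ∀ i ∈ Finset.Icc 1 r, h i ≤ r) :
    Real.log (Real.sqrt (2 * (∏ i ∈ Finset.Icc 1 r, q i ^ h i : ℕ))) ≤ (r : ℝ) ^ 4 := by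
  have hr' : (2 : ℝ) ≤ r := by exact_mod_cast hr
  have hpos : 0 < ∏ i ∈ Finset.Icc 1 r, q i ^ h i :=
    Finset.prod_pos fun i hi => pow_pos (hq0 i hi) _
  have hle : ∏ i ∈ Finset.Icc 1 r, q i ^ h i ≤ r ^ (2 * r * r) := by
    calc ∏ i ∈ Finset.Icc 1 r, q i ^ h i ≤ ∏ i ∈ Finset.Icc 1 r, (r ^ 2) ^ r := by
          refine Finset.prod_le_prod' fun i hi => ?_
          exact (Nat.pow_le_pow_left (hq i hi) _).trans
            (Nat.pow_le_pow_right (by positivity) (hh i hi))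
      _ = r ^ (2 * r * r) := by simp [← pow_mul]
  have hpos' : (0 : ℝ) < (∏ i ∈ Finset.Icc 1 r, q i ^ h i : ℕ) := by exact_mod_cast hpos
  have hlog : Real.log (∏ i ∈ Finset.Icc 1 r, q i ^ h i : ℕ) ≤ 2 * r * r * Real.log r := by
    have := Real.log_le_log hpos' (by exact_mod_cast hle :
      ((∏ i ∈ Finset.Icc 1 r, q i ^ h i : ℕ) : ℝ) ≤ (r : ℝ) ^ (2 * r * r))
    rw [Real.log_pow] at this
    simpa using this
  have hlogr : Real.log r ≤ r := (Real.log_le_sub_one_of_pos (by linarith)).trans (by linarith)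
  rw [Real.log_sqrt (by positivity), Real.log_mul (by norm_num) hpos'.ne']
  have h1 : 2 * (r : ℝ) * r * Real.log r ≤ 2 * r * r * r :=
    mul_le_mul_of_nonneg_left hlogr (by positivity)
  have h2 : (8 : ℝ) ≤ r ^ 3 := by nlinarith [sq_nonneg ((r : ℝ) - 2)]
  nlinarith [Real.log_two_lt_d9, mul_le_mul_of_nonneg_right hr' (by positivity : 0 ≤ (r : ℝ) ^ 3)]

/-- There is a constant `R` so that for all `r ≥ R`: with `q_i` the `i`-th prime,
`1 ≤ h_i ≤ r/i`, `Λ = ∏_{i=1}^r q_i^{h_i}`,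
`N = (Λ/(φ(Λ)·ln √(2Λ))) · ∏ (h_i + (q_i−2)/(q_i−1))`, and `m` (with `10 < m ≤ r`)
minimal such that `N·∏_{i=m+1}^r 1/(h_i+1) > (log₂ Λ)·4^{√(∑_{i=1}^m h_i log₂ q_i)}`,
one has `∑_{i=1}^m h_i log₂ q_i < 27 (log₂ N)(log₂ log₂ N)²`. -/
theorem log_G_bound :
    ∃ R : ℕ, ∀ r : ℕ, R ≤ r → ∀ h : ℕ → ℕ,
      (∀ i ∈ Finset.Icc 1 r, 1 ≤ h i ∧ (h i : ℝ) ≤ (r : ℝ) / i) →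
      ∀ Λ : ℕ, Λ = ∏ i ∈ Finset.Icc 1 r, (Nat.nth Nat.Prime (i - 1)) ^ h i →
      ∀ N : ℝ,
        N = (Λ : ℝ) / ((Nat.totient Λ : ℝ) * Real.log (Real.sqrt (2 * Λ)))
          * ∏ i ∈ Finset.Icc 1 r,
              ((h i : ℝ) + ((Nat.nth Nat.Prime (i - 1) : ℝ) - 2)
                / ((Nat.nth Nat.Prime (i - 1) : ℝ) - 1)) →
      ∀ m : ℕ, 10 < m → m ≤ r →
        (N * ∏ i ∈ Finset.Icc (m + 1) r, (1 : ℝ) / ((h i : ℝ) + 1)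
          > Real.logb 2 Λ * (4 : ℝ) ^
              Real.sqrt (∑ i ∈ Finset.Icc 1 m,
                (h i : ℝ) * Real.logb 2 (Nat.nth Nat.Prime (i - 1)))) →
        (∀ m' : ℕ, 0 < m' → m' < m →
          ¬ (N * ∏ i ∈ Finset.Icc (m' + 1) r, (1 : ℝ) / ((h i : ℝ) + 1)
            > Real.logb 2 Λ * (4 : ℝ) ^
                Real.sqrt (∑ i ∈ Finset.Icc 1 m',
                  (h i : ℝ) * Real.logb 2 (Nat.nth Nat.Prime (i - 1))))) →
        ∑ i ∈ Finset.Icc 1 m, (h i : ℝ) * Real.logb 2 (Nat.nth Nat.Prime (i - 1))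
          < 27 * Real.logb 2 N * (Real.logb 2 (Real.logb 2 N)) ^ 2 := by
  have hev : ∀ᶠ r : ℕ in Filter.atTop, Real.log r ≤ (r : ℝ) / 100 := by
    have := (Real.isLittleO_log_id_atTop.comp_tendsto tendsto_natCast_atTop_atTop).bound
      (by norm_num : (0 : ℝ) < 1 / 100)
    filter_upwards [this] with r hr
    have := (le_abs_self _).trans hr
    simp only [Function.comp, id, Real.norm_natCast] at this
    linarith
  obtain ⟨R, hR⟩ := Filter.eventually_atTop.mp hev
  refine ⟨max R 100, fun r hr h hh Λ hΛ N hN m _ hmr _ _ => ?_⟩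
  have hlog : Real.log r ≤ (r : ℝ) / 100 := hR r (le_of_max_le_left hr)
  have hr100 : 100 ≤ r := le_of_max_le_right hr
  have hr' : (100 : ℝ) ≤ r := by exact_mod_cast hr100
  have hq0 : ∀ i, 0 < Nat.nth Nat.Prime i := fun i => (Nat.prime_nth_prime i).pos
  have hq : ∀ i ∈ Finset.Icc 1 r, Nat.nth Nat.Prime (i - 1) ≤ r ^ 2 := fun i hi => by
    rw [Finset.mem_Icc] at hi
    exact nth_prime_le_sq_s11 (by omega) hlog (by omega)
  have hhr : ∀ i ∈ Finset.Icc 1 r, h i ≤ r := fun i hi => by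
    have h1 : (1 : ℝ) ≤ i := by exact_mod_cast (Finset.mem_Icc.mp hi).1
    have h2 := (hh i hi).2.trans (div_le_self (by positivity) h1)
    exact_mod_cast h2
  set L := Real.logb 2 r with hL
  have hlogL : Real.log r = L * Real.log 2 := by
    rw [hL, Real.logb, div_mul_cancel₀ _ (Real.log_pos (by norm_num)).ne']
  have hl2 := Real.log_two_gt_d9
  have hl2' := Real.log_two_lt_d9
  have hL4 : 4 ≤ L := by
    rw [hL, Real.le_logb_iff_rpow_le (by norm_num) (by linarith)]
    norm_num
    linarith
  have hsum : ∑ i ∈ Finset.Icc 1 m, (h i : ℝ) * Real.logb 2 (Nat.nth Nat.Prime (i - 1))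
      ≤ 2 * r * L ^ 2 := by
    calc ∑ i ∈ Finset.Icc 1 m, (h i : ℝ) * Real.logb 2 (Nat.nth Nat.Prime (i - 1))
        ≤ ∑ i ∈ Finset.Icc 1 m, ((r : ℝ) / i) * (2 * L) := by
          refine Finset.sum_le_sum fun i hi => ?_
          have hi' : i ∈ Finset.Icc 1 r := Finset.Icc_subset_Icc_right hmr hi
          have hqi : Real.logb 2 (Nat.nth Nat.Prime (i - 1)) ≤ 2 * L := by
            have h1 : ((Nat.nth Nat.Prime (i - 1) : ℕ) : ℝ) ≤ (r : ℝ) ^ 2 := by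
              exact_mod_cast hq i hi'
            have h2 := Real.logb_le_logb_of_le (by norm_num : (1 : ℝ) < 2)
              (by exact_mod_cast hq0 (i - 1)) h1
            rw [Real.logb_pow] at h2
            exact_mod_cast h2
          exact mul_le_mul (hh i hi').2 hqi
            (Real.logb_nonneg (by norm_num) (by exact_mod_cast hq0 (i - 1))) (by positivity)
      _ = (∑ i ∈ Finset.Icc 1 m, (1 : ℝ) / i) * (2 * r * L) := by
          rw [Finset.sum_mul]
          exact Finset.sum_congr rfl fun i _ => by ring
      _ ≤ L * (2 * r * L) := by
          refine mul_le_mul_of_nonneg_right ?_ (by positivity)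
          calc ∑ i ∈ Finset.Icc 1 m, (1 : ℝ) / i ≤ ∑ i ∈ Finset.Icc 1 r, (1 : ℝ) / i :=
                Finset.sum_le_sum_of_subset_of_nonneg (Finset.Icc_subset_Icc_right hmr)
                  fun _ _ _ => by positivity
            _ ≤ 1 + Real.log r := sum_Icc_inv_le_one_add_log r
            _ ≤ L := by rw [hlogL]; nlinarith
      _ = 2 * r * L ^ 2 := by ring
  have hΛ0 : 0 < Λ := hΛ ▸ Finset.prod_pos fun i _ => pow_pos (hq0 _) _
  have hΛ1 : (1 : ℝ) ≤ Λ := by exact_mod_cast hΛ0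
  set D := Real.log (Real.sqrt (2 * Λ)) with hD
  have hD0 : 0 < D := by
    rw [hD, Real.log_sqrt (by positivity)]
    have := Real.log_pos (by linarith : (1 : ℝ) < 2 * Λ)
    positivity
  have hD4 : D ≤ (r : ℝ) ^ 4 := by
    rw [hD, hΛ]
    exact log_sqrt_two_mul_prod_le (by omega) (fun i _ => hq0 _) hq hhr
  have hNge : (3 / 2 : ℝ) ^ (r - 1) / (r : ℝ) ^ 4 ≤ N := by
    have hprod := three_halves_pow_le_prod (by omega : 1 ≤ r) fun i hi => (hh i hi).1
    have hφ0 : (0 : ℝ) < Nat.totient Λ := by exact_mod_cast Nat.totient_pos.mpr hΛ0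
    have hφ : (Nat.totient Λ : ℝ) ≤ Λ := by exact_mod_cast Nat.totient_le Λ
    have hfac : 1 / (r : ℝ) ^ 4 ≤ (Λ : ℝ) / ((Nat.totient Λ : ℝ) * D) := by
      rw [div_le_div_iff₀ (by positivity) (by positivity), one_mul]
      exact mul_le_mul hφ hD4 hD0.le (by positivity)
    rw [hN, div_eq_mul_one_div, mul_comm]
    exact mul_le_mul hfac hprod (by positivity) (by positivity)
  have hlogN : (r : ℝ) / 3 ≤ Real.logb 2 N := by
    have h1 := Real.logb_le_logb_of_le (by norm_num : (1 : ℝ) < 2) (by positivity) hNge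
    rw [Real.logb_div (by positivity) (by positivity), Real.logb_pow 2 (r : ℝ) 4] at h1
    have h2 := half_le_logb_three_halves_pow (by omega : 1 ≤ r)
    push_cast at h1
    have h3 : L ≤ (r : ℝ) / 60 := by nlinarith
    linarith
  have hloglogN : L / 2 ≤ Real.logb 2 (Real.logb 2 N) := by
    have h1 : Real.sqrt r ≤ Real.logb 2 N := by
      refine le_trans ?_ hlogN
      rw [Real.sqrt_le_left (by positivity)]
      nlinarith
    have h2 := Real.logb_le_logb_of_le (by norm_num : (1 : ℝ) < 2)
      (Real.sqrt_pos.mpr (by linarith)) h1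
    rwa [Real.logb, Real.log_sqrt (by positivity), div_right_comm] at h2
  calc _ ≤ 2 * r * L ^ 2 := hsum
    _ < 27 * ((r : ℝ) / 3) * (L / 2) ^ 2 := by
      nlinarith [mul_pos (by linarith : (0 : ℝ) < r) (pow_pos (by linarith : 0 < L) 2)]
    _ ≤ 27 * Real.logb 2 N * (Real.logb 2 (Real.logb 2 N)) ^ 2 := by
      have : 0 ≤ Real.logb 2 N := le_trans (by positivity) hlogN
      have : 27 * ((r : ℝ) / 3) ≤ 27 * Real.logb 2 N := by gcongr
      gcongr
end

section
/- There exists a constant R such that the following holds for all integers r ≥ R. Let q₁ < q₂ < … denote the primes in increasing order, let h₁, …, h_r be integers with 1 ≤ h_i ≤ r/i, set Λ = ∏_{i=1}^r q_i^{h_i}, and let N = (Λ / (φ(Λ) · ln√(2Λ))) · ∏_{i=1}^r (h_i + (q_i − 2)/(q_i − 1)). Suppose m is an integer with 10 < m ≤ r that is minimal with the property that N · ∏_{i=m+1}^r 1/(h_i + 1) > (log₂ Λ) · 4^{√(∑_{i=1}^m h_i log₂ q_i)}. Then m < 6·√r·log₂ r. -/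
/-- Chebyshev's bound implies that each of the first `r` primes is at most `r ^ 4`. -/
theorem nth_prime_le_pow_four {r i : ℕ} (hr : 4 ≤ r) (hi : i < r) :
    Nat.nth Nat.Prime i ≤ r ^ 4 := by
  suffices h : r ≤ Nat.primeCounting (r ^ 4) from
    Nat.lt_succ_iff.mp (Nat.nth_lt_of_lt_count (lt_of_lt_of_le hi h))
  have hr' : (4 : ℝ) ≤ r := by exact_mod_cast hr
  have hr0 : (0 : ℝ) < r := by linarith
  have hlog : Real.log r ≤ r := (Real.log_le_sub_one_of_pos hr0).trans (by linarith)
  have hlogpos : 0 < Real.log r := Real.log_pos (by linarith)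
  have hlog1 : Real.log ((r : ℝ) ^ 4 + 1) ≤ 5 * Real.log r := by
    have h5 : (5 : ℝ) * Real.log r = Real.log ((r : ℝ) ^ 5) := by
      rw [Real.log_pow]; norm_num
    rw [h5]
    refine Real.log_le_log (by positivity) ?_
    have h4 : (1 : ℝ) ≤ (r : ℝ) ^ 4 := one_le_pow₀ (by linarith)
    nlinarith
  have hpi := Chebyshev.pi_ge (r ^ 4)
  push_cast at hpi
  rw [Real.log_pow, div_le_iff₀ (by push_cast; linarith)] at hpi
  push_cast at hpi
  by_contra! hlt
  have hlt' : (Nat.primeCounting (r ^ 4) : ℝ) ≤ r := by exact_mod_cast hlt.le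
  have h1 : (Nat.primeCounting (r ^ 4) : ℝ) * (4 * Real.log r) ≤ r * (4 * r) := by gcongr
  have h2 : (r : ℝ) ^ 4 * (1 / 2) ≤ (r : ℝ) ^ 4 * Real.log 2 := by
    gcongr
    linarith [Real.log_two_gt_d9]
  have h3 : (16 : ℝ) * r ^ 2 ≤ r ^ 4 := by
    have : (16 : ℝ) ≤ r ^ 2 := by nlinarith
    nlinarith
  nlinarith

/-- A harmonic-type bound for `log₂ ∏ q_i ^ h_i` when `h_i ≤ r / i` and `q_i ≤ r ^ 4`. -/
theorem sum_mul_logb_le {r : ℕ} (hr : 100 ≤ r) (h : ℕ → ℕ)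
    (hh : ∀ i ∈ Finset.Icc 1 r, (h i : ℝ) ≤ (r : ℝ) / i) :
    ∑ i ∈ Finset.Icc 1 r, (h i : ℝ) * Real.logb 2 (Nat.nth Nat.Prime (i - 1))
      ≤ 4 * r * Real.logb 2 r ^ 2 := by
  have hr' : (100 : ℝ) ≤ r := by exact_mod_cast hr
  have hL : 0 ≤ Real.logb 2 r := Real.logb_nonneg (by norm_num) (by linarith)
  have hq : ∀ i ∈ Finset.Icc 1 r,
      Real.logb 2 (Nat.nth Nat.Prime (i - 1)) ≤ 4 * Real.logb 2 r := by
    intro i hi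
    have hi' := Finset.mem_Icc.mp hi
    have h4 : (4 : ℝ) * Real.logb 2 r = Real.logb 2 ((r : ℝ) ^ 4) := by
      rw [Real.logb_pow]; norm_num
    rw [h4]
    refine Real.logb_le_logb_of_le (by norm_num) ?_ ?_
    · exact_mod_cast (Nat.prime_nth_prime _).pos
    · exact_mod_cast nth_prime_le_pow_four (by omega) (by omega)
  have hharm : (∑ i ∈ Finset.Icc 1 r, ((i : ℝ))⁻¹) ≤ Real.logb 2 r := by
    have h1 := harmonic_le_one_add_log r
    rw [harmonic_eq_sum_Icc] at h1
    push_cast at h1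
    refine h1.trans ?_
    have h2 : Real.log r = Real.logb 2 r * Real.log 2 := by
      rw [Real.logb, div_mul_cancel₀ _ (Real.log_pos (by norm_num)).ne']
    have h3 : (4 : ℝ) ≤ Real.logb 2 r := by
      rw [Real.le_logb_iff_rpow_le (by norm_num) (by linarith)]
      norm_num
      linarith
    rw [h2]
    nlinarith [Real.log_two_lt_d9]
  calc ∑ i ∈ Finset.Icc 1 r, (h i : ℝ) * Real.logb 2 (Nat.nth Nat.Prime (i - 1))
      ≤ ∑ i ∈ Finset.Icc 1 r, (i : ℝ)⁻¹ * (r * (4 * Real.logb 2 r)) := by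
        refine Finset.sum_le_sum fun i hi ↦ ?_
        calc (h i : ℝ) * Real.logb 2 (Nat.nth Nat.Prime (i - 1))
            ≤ (r / i) * (4 * Real.logb 2 r) :=
              mul_le_mul (hh i hi) (hq i hi)
                (Real.logb_nonneg (by norm_num)
                  (by exact_mod_cast (Nat.prime_nth_prime _).one_le)) (by positivity)
          _ = _ := by ring
    _ = (∑ i ∈ Finset.Icc 1 r, (i : ℝ)⁻¹) * (r * (4 * Real.logb 2 r)) := by
        rw [Finset.sum_mul]
    _ ≤ Real.logb 2 r * (r * (4 * Real.logb 2 r)) := by gcongr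
    _ = _ := by ring

/-- The quotient `n / φ(n)` for a product of powers of distinct primes. -/
theorem prod_prime_pow_div_totient {ι : Type*} [DecidableEq ι] (s : Finset ι) (q h : ι → ℕ)
    (hq : ∀ i ∈ s, (q i).Prime) (hh : ∀ i ∈ s, 0 < h i) (hinj : Set.InjOn q s) :
    ((∏ i ∈ s, q i ^ h i : ℕ) : ℝ) / (Nat.totient (∏ i ∈ s, q i ^ h i) : ℝ)
      = ∏ i ∈ s, (q i : ℝ) / ((q i : ℝ) - 1) := by
  induction s using Finset.induction_on with
  | empty => simp
  | insert a s ha ih =>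
    have hpa := hq a (Finset.mem_insert_self a s)
    have hcop : Nat.Coprime (q a ^ h a) (∏ i ∈ s, q i ^ h i) := by
      refine Nat.Coprime.prod_right fun i hi ↦ Nat.Coprime.pow _ _ ?_
      refine (Nat.coprime_primes hpa (hq i (Finset.mem_insert_of_mem hi))).mpr fun he ↦ ?_
      have := hinj (by simp) (by simp [hi]) he
      exact ha (this ▸ hi)
    rw [Finset.prod_insert ha, Finset.prod_insert ha, Nat.totient_mul hcop,
      Nat.cast_mul, Nat.cast_mul, mul_div_mul_comm,
      ih (fun i hi ↦ hq i (Finset.mem_insert_of_mem hi))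
        (fun i hi ↦ hh i (Finset.mem_insert_of_mem hi))
        (hinj.mono (by simp))]
    congr 1
    obtain ⟨k, hk⟩ : ∃ k, h a = k + 1 := ⟨h a - 1, by have := hh a (by simp); omega⟩
    rw [hk, Nat.totient_prime_pow_succ hpa, Nat.cast_mul, Nat.cast_sub hpa.one_le]
    have hq0 : (q a : ℝ) ≠ 0 := by exact_mod_cast hpa.ne_zero
    push_cast
    rw [pow_succ, mul_div_mul_left _ _ (pow_ne_zero _ hq0)]

theorem add_one_le_div_mul_add {q h : ℝ} (hq : 2 ≤ q) (hh : 1 ≤ h) :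
    h + 1 ≤ q / (q - 1) * (h + (q - 2) / (q - 1)) := by
  have hq1 : 0 < q - 1 := by linarith
  have he : q / (q - 1) * (h + (q - 2) / (q - 1))
      = q * (h * (q - 1) + (q - 2)) / (q - 1) ^ 2 := by
    field_simp
  rw [he, le_div_iff₀ (by positivity)]
  nlinarith [mul_nonneg (sub_nonneg.mpr hh) hq1.le]

/-- Dividing the factors with index above `n` by `h i + 1` leaves a product of at least `2 ^ n`. -/
theorem two_pow_le_prod_mul_prod {r n : ℕ} (hn : n ≤ r) (q h : ℕ → ℝ)
    (hq : ∀ i ∈ Finset.Icc 1 r, 2 ≤ q i) (hh : ∀ i ∈ Finset.Icc 1 r, 1 ≤ h i) :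
    2 ^ n ≤ (∏ i ∈ Finset.Icc 1 r, q i / (q i - 1)) *
      (∏ i ∈ Finset.Icc 1 r, (h i + (q i - 2) / (q i - 1))) *
      ∏ i ∈ Finset.Icc (n + 1) r, 1 / (h i + 1) := by
  have hsplit : Finset.Icc 1 r = Finset.Icc 1 n ∪ Finset.Icc (n + 1) r := by
    ext i; simp only [Finset.mem_union, Finset.mem_Icc]; omega
  have hdisj : Disjoint (Finset.Icc 1 n) (Finset.Icc (n + 1) r) := by
    rw [Finset.disjoint_left]; intro i; simp only [Finset.mem_Icc]; omega
  have hl : ∀ i ∈ Finset.Icc 1 n, i ∈ Finset.Icc 1 r := by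
    rw [hsplit]; exact fun i hi ↦ Finset.mem_union_left _ hi
  have hu : ∀ i ∈ Finset.Icc (n + 1) r, i ∈ Finset.Icc 1 r := by
    rw [hsplit]; exact fun i hi ↦ Finset.mem_union_right _ hi
  rw [← Finset.prod_mul_distrib]
  conv_rhs => rw [hsplit]
  rw [Finset.prod_union hdisj, mul_assoc, ← Finset.prod_mul_distrib]
  have h1 : (2 : ℝ) ^ n ≤
      ∏ i ∈ Finset.Icc 1 n, q i / (q i - 1) * (h i + (q i - 2) / (q i - 1)) := by
    have := Finset.prod_le_prod (s := Finset.Icc 1 n) (f := fun _ ↦ (2 : ℝ))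
      (g := fun i ↦ q i / (q i - 1) * (h i + (q i - 2) / (q i - 1))) (fun _ _ ↦ by norm_num)
      (fun i hi ↦ le_trans (by linarith [hh i (hl i hi)])
        (add_one_le_div_mul_add (hq i (hl i hi)) (hh i (hl i hi))))
    simpa using this
  have h2 : (1 : ℝ) ≤ ∏ i ∈ Finset.Icc (n + 1) r,
      q i / (q i - 1) * (h i + (q i - 2) / (q i - 1)) * (1 / (h i + 1)) := by
    refine (Finset.prod_const_one (s := Finset.Icc (n + 1) r)).symm.trans_le ?_
    refine Finset.prod_le_prod (fun _ _ ↦ zero_le_one) fun i hi ↦ ?_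
    have hi1 := hh i (hu i hi)
    rw [mul_one_div, one_le_div (by linarith)]
    exact add_one_le_div_mul_add (hq i (hu i hi)) hi1
  calc (2 : ℝ) ^ n = 2 ^ n * 1 := (mul_one _).symm
    _ ≤ _ := mul_le_mul h1 h2 zero_le_one (le_trans (by positivity) h1)


/-- There is a constant `R` so that for all `r ≥ R`: with `q_i` the `i`-th prime,
`1 ≤ h_i ≤ r/i`, `Λ = ∏_{i=1}^r q_i^{h_i}`,
`N = (Λ/(φ(Λ)·ln √(2Λ))) · ∏ (h_i + (q_i−2)/(q_i−1))`, and `m` (with `10 < m ≤ r`)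
minimal such that `N·∏_{i=m+1}^r 1/(h_i+1) > (log₂ Λ)·4^{√(∑_{i=1}^m h_i log₂ q_i)}`,
one has `m < 6 √r log₂ r`. -/
theorem m_bound :
    ∃ R : ℕ, ∀ r : ℕ, R ≤ r → ∀ h : ℕ → ℕ,
      (∀ i ∈ Finset.Icc 1 r, 1 ≤ h i ∧ (h i : ℝ) ≤ (r : ℝ) / i) →
      ∀ Λ : ℕ, Λ = ∏ i ∈ Finset.Icc 1 r, (Nat.nth Nat.Prime (i - 1)) ^ h i →
      ∀ N : ℝ,
        N = (Λ : ℝ) / ((Nat.totient Λ : ℝ) * Real.log (Real.sqrt (2 * Λ)))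
          * ∏ i ∈ Finset.Icc 1 r,
              ((h i : ℝ) + ((Nat.nth Nat.Prime (i - 1) : ℝ) - 2)
                / ((Nat.nth Nat.Prime (i - 1) : ℝ) - 1)) →
      ∀ m : ℕ, 10 < m → m ≤ r →
        (N * ∏ i ∈ Finset.Icc (m + 1) r, (1 : ℝ) / ((h i : ℝ) + 1)
          > Real.logb 2 Λ * (4 : ℝ) ^
              Real.sqrt (∑ i ∈ Finset.Icc 1 m,
                (h i : ℝ) * Real.logb 2 (Nat.nth Nat.Prime (i - 1)))) →
        (∀ m' : ℕ, 0 < m' → m' < m →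
          ¬ (N * ∏ i ∈ Finset.Icc (m' + 1) r, (1 : ℝ) / ((h i : ℝ) + 1)
            > Real.logb 2 Λ * (4 : ℝ) ^
                Real.sqrt (∑ i ∈ Finset.Icc 1 m',
                  (h i : ℝ) * Real.logb 2 (Nat.nth Nat.Prime (i - 1))))) →
        (m : ℝ) < 6 * Real.sqrt r * Real.logb 2 r := by
  refine ⟨100, fun r hr h hh Λ hΛ N hN m hm hmr _ hmin ↦ ?_⟩
  obtain ⟨n, rfl⟩ : ∃ n, m = n + 1 := ⟨m - 1, by omega⟩
  have hr' : (100 : ℝ) ≤ r := by exact_mod_cast hr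
  have hfail := not_lt.mp (hmin n (by omega) (by omega))
  set q : ℕ → ℕ := fun i ↦ Nat.nth Nat.Prime (i - 1) with hqdef
  have hqp : ∀ i, (q i).Prime := fun i ↦ Nat.prime_nth_prime _
  have hq2 : ∀ i, (2 : ℝ) ≤ q i := fun i ↦ by exact_mod_cast (hqp i).two_le
  have hterm : ∀ i, 0 ≤ (h i : ℝ) * Real.logb 2 (q i) := fun i ↦
    mul_nonneg (Nat.cast_nonneg _) (Real.logb_nonneg (by norm_num) (by linarith [hq2 i]))
  have hinj : Set.InjOn q (Finset.Icc 1 r) := by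
    intro i hi j hj hij
    have := Nat.nth_injective Nat.infinite_setOfPred_prime hij
    simp only [Finset.coe_Icc, Set.mem_Icc] at hi hj
    omega
  have hlogΛ : Real.logb 2 Λ = ∑ i ∈ Finset.Icc 1 r, (h i : ℝ) * Real.logb 2 (q i) := by
    rw [hΛ, Nat.cast_prod, Real.logb_prod]
    · refine Finset.sum_congr rfl fun i _ ↦ ?_
      rw [Nat.cast_pow, Real.logb_pow]
    · intro i _
      exact_mod_cast pow_ne_zero _ (hqp i).ne_zero
  have hratio : (Λ : ℝ) / (Nat.totient Λ : ℝ)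
      = ∏ i ∈ Finset.Icc 1 r, (q i : ℝ) / ((q i : ℝ) - 1) := by
    rw [hΛ]
    exact prod_prime_pow_div_totient _ q h (fun i _ ↦ hqp i) (fun i hi ↦ (hh i hi).1) hinj
  have hΛ2 : (2 : ℝ) ≤ Λ := by
    have hΛpos : 0 < Λ := by
      rw [hΛ]; exact Finset.prod_pos fun i _ ↦ pow_pos (hqp i).pos _
    have hmem : 1 ∈ Finset.Icc 1 r := by simp; omega
    have hdvd : q 1 ∣ Λ := by
      rw [hΛ]
      exact (dvd_pow_self _ (by have := (hh 1 hmem).1; omega)).trans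
        (Finset.dvd_prod_of_mem (fun i ↦ q i ^ h i) hmem)
    exact (hq2 1).trans (by exact_mod_cast Nat.le_of_dvd hΛpos hdvd)
  set T := Real.logb 2 Λ with hT
  set L := Real.logb 2 r with hLdef
  have hlog2 : 0 < Real.log 2 := Real.log_pos (by norm_num)
  have hTlog : Real.log Λ = T * Real.log 2 := by
    rw [hT, Real.logb, div_mul_cancel₀ _ hlog2.ne']
  have hT1 : 1 ≤ T := by
    rw [hT, Real.le_logb_iff_rpow_le (by norm_num) (by linarith)]
    simpa using hΛ2
  have hD : Real.log (Real.sqrt (2 * Λ)) = (1 + T) * Real.log 2 / 2 := by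
    rw [Real.log_sqrt (by positivity), Real.log_mul (by norm_num) (by linarith), hTlog]
    ring
  have hDpos : 0 < Real.log (Real.sqrt (2 * Λ)) := by rw [hD]; positivity
  have hDle : Real.log (Real.sqrt (2 * Λ)) ≤ T := by
    rw [hD]; nlinarith [Real.log_two_lt_d9]
  have hprod := two_pow_le_prod_mul_prod (r := r) (n := n) (by omega) (fun i ↦ (q i : ℝ))
    (fun i ↦ (h i : ℝ)) (fun i _ ↦ hq2 i) (fun i hi ↦ by exact_mod_cast (hh i hi).1)
  rw [← hratio] at hprod
  have hpow : (2 : ℝ) ^ n ≤ T * T * (4 : ℝ) ^ Real.sqrt T := by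
    have hsqrt : Real.sqrt (∑ i ∈ Finset.Icc 1 n, (h i : ℝ) * Real.logb 2 (q i))
        ≤ Real.sqrt T := by
      refine Real.sqrt_le_sqrt ?_
      rw [hlogΛ]
      exact Finset.sum_le_sum_of_subset_of_nonneg
        (Finset.Icc_subset_Icc_right (by omega)) (fun i _ _ ↦ hterm i)
    calc (2 : ℝ) ^ n ≤ _ := hprod
      _ = (N * ∏ i ∈ Finset.Icc (n + 1) r, (1 : ℝ) / ((h i : ℝ) + 1))
          * Real.log (Real.sqrt (2 * Λ)) := by
        have hcancel : ∀ A D P Q : ℝ, D ≠ 0 → A * P * Q = A / D * P * Q * D := by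
          intro A D P Q hD0
          field_simp
        rw [hN, ← div_div]
        exact hcancel _ _ _ _ hDpos.ne'
      _ ≤ (T * (4 : ℝ) ^ Real.sqrt (∑ i ∈ Finset.Icc 1 n, (h i : ℝ) * Real.logb 2 (q i)))
          * T := by
        gcongr
      _ ≤ (T * (4 : ℝ) ^ Real.sqrt T) * T := by
        gcongr
        norm_num
      _ = _ := by ring
  have hTle : T ≤ 4 * r * L ^ 2 := hlogΛ ▸ sum_mul_logb_le hr h (fun i hi ↦ (hh i hi).2)
  have hL4 : 4 ≤ L := by
    rw [hLdef, Real.le_logb_iff_rpow_le (by norm_num) (by linarith)]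
    norm_num
    linarith
  have hTpos : 0 < T := by linarith
  have hlin : (n : ℝ) ≤ 2 * Real.logb 2 T + 2 * Real.sqrt T := by
    have h1 := Real.logb_le_logb_of_le (b := 2) (by norm_num) (by positivity) hpow
    have h4 : Real.logb 2 4 = 2 := by
      rw [show (4 : ℝ) = 2 ^ (2 : ℕ) by norm_num, Real.logb_pow]; simp
    rw [Real.logb_pow, Real.logb_mul (by positivity) (by positivity),
      Real.logb_mul hTpos.ne' hTpos.ne', Real.logb_rpow_eq_mul_logb_of_pos (by norm_num), h4,
      Real.logb_self_eq_one (by norm_num)] at h1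
    linarith
  have hLr : L ≤ r := by
    rw [hLdef, Real.logb_le_iff_le_rpow (by norm_num) (by linarith), Real.rpow_natCast]
    exact_mod_cast Nat.lt_two_pow_self.le
  have hlogT : Real.logb 2 T ≤ 2 + 3 * L := by
    have hT3 : T ≤ 2 ^ 2 * (r : ℝ) ^ 3 := by
      refine hTle.trans ?_
      have : L ^ 2 ≤ (r : ℝ) ^ 2 := by gcongr
      nlinarith
    have h1 := Real.logb_le_logb_of_le (b := 2) (by norm_num) hTpos hT3
    rw [Real.logb_mul (by positivity) (by positivity), Real.logb_pow, Real.logb_pow,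
      Real.logb_self_eq_one (by norm_num)] at h1
    push_cast at h1
    linarith
  have hsqrtT : Real.sqrt T ≤ 2 * Real.sqrt r * L := by
    refine Real.sqrt_le_iff.mpr ⟨by positivity, ?_⟩
    rw [mul_pow, mul_pow, Real.sq_sqrt (by linarith)]
    linarith
  have hsr : 10 ≤ Real.sqrt r := Real.le_sqrt_of_sq_le (by linarith)
  push_cast
  nlinarith
end

section
/- Let q₁ < q₂ < … denote the primes in increasing order. For every integer r ≥ 16, the sum of the reciprocals of the first r primes satisfies ∑_{j=1}^r 1/q_j < 2·ln(ln r). -/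
theorem Nat.factorial_succ_le_four_pow_nth_prime (n : ℕ) :
    (n + 1).factorial ≤ 4 ^ Nat.nth Nat.Prime n := by
  calc (n + 1).factorial = ∏ j ∈ Finset.range (n + 1), (j + 1) :=
        (Finset.prod_range_add_one_eq_factorial _).symm
    _ ≤ ∏ j ∈ Finset.range (n + 1), Nat.nth Nat.Prime j := by
        refine Finset.prod_le_prod' fun j _ => ?_
        have := Nat.add_two_le_nth_prime j
        omega
    _ = ∏ p ∈ (Finset.range (n + 1)).image (Nat.nth Nat.Prime), p :=
        (Finset.prod_image (f := fun p : ℕ => p)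
          (Nat.nth_injective Nat.infinite_setOfPred_prime).injOn).symm
    _ ≤ primorial (Nat.nth Nat.Prime n) := by
        refine Finset.prod_le_prod_of_subset_of_one_le' ?_ fun p hp _ =>
          (Finset.mem_filter.1 hp).2.one_le
        intro p hp
        obtain ⟨j, hj, rfl⟩ := Finset.mem_image.1 hp
        have h : Nat.nth Nat.Prime j ≤ Nat.nth Nat.Prime n :=
          Nat.nth_monotone Nat.infinite_setOfPred_prime (Nat.lt_succ_iff.1 (Finset.mem_range.1 hj))
        exact Finset.mem_filter.2 ⟨Finset.mem_range.2 (Nat.lt_succ_of_le h), Nat.prime_nth_prime j⟩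
    _ ≤ 4 ^ Nat.nth Nat.Prime n := primorial_le_four_pow _

theorem Nat.nth_prime_sixteen_eq_fifty_nine : Nat.nth Nat.Prime 16 = 59 :=
  Nat.nth_count (by norm_num : Nat.Prime 59)

theorem Real.log_four_eq_two_mul_log_two : Real.log 4 = 2 * Real.log 2 := by
  rw [show (4 : ℝ) = 2 ^ 2 by norm_num, Real.log_pow]
  norm_num

theorem mul_log_le_two_mul_nth_prime {n : ℕ} (hn : 16 ≤ n) :
    ((n : ℝ) + 1) * Real.log (n + 1) ≤ 2 * Nat.nth Nat.Prime n := by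
  have hlog2 := Real.log_two_lt_d9
  have hpos : (0 : ℝ) < (n : ℝ) + 1 := by positivity
  rcases le_or_gt n 30 with h | h
  · have hq : (59 : ℝ) ≤ Nat.nth Nat.Prime n := by
      exact_mod_cast Nat.nth_prime_sixteen_eq_fifty_nine ▸
        Nat.nth_monotone Nat.infinite_setOfPred_prime hn
    have hn' : (n : ℝ) ≤ 30 := by exact_mod_cast h
    have hlog : Real.log (n + 1) ≤ 5 * Real.log 2 := by
      rw [show 5 * Real.log 2 = Real.log ((2 : ℝ) ^ 5) by rw [Real.log_pow]; norm_num]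
      exact Real.log_le_log hpos (by linarith)
    nlinarith
  · have hn' : (31 : ℝ) ≤ n := by exact_mod_cast h
    have hlog : 5 * Real.log 2 ≤ Real.log (n + 1) := by
      rw [show 5 * Real.log 2 = Real.log ((2 : ℝ) ^ 5) by rw [Real.log_pow]; norm_num]
      exact Real.log_le_log (by norm_num) (by linarith)
    have hfac : ((n + 1).factorial : ℝ) ≤ 4 ^ Nat.nth Nat.Prime n := by
      exact_mod_cast Nat.factorial_succ_le_four_pow_nth_prime n
    have hle := Real.log_le_log (by positivity) hfac
    have hst := Stirling.le_log_factorial_stirling (n := n + 1) (by omega)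
    have h2pi : 0 ≤ Real.log (2 * Real.pi) :=
      Real.log_nonneg (by linarith [Real.pi_gt_three])
    have hgt := Real.log_two_gt_d9
    rw [Real.log_pow, Real.log_four_eq_two_mul_log_two] at hle
    push_cast at hst
    have hmain : ((n : ℝ) + 1) * (Real.log (n + 1) - 1) ≤
        (Nat.nth Nat.Prime n : ℝ) * (2 * Real.log 2) := by linarith
    have hq : (0 : ℝ) ≤ Nat.nth Nat.Prime n := Nat.cast_nonneg _
    have h1 : Real.log (n + 1) * 0.7 ≤ Real.log (n + 1) - 1 := by linarith
    nlinarith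

theorem Real.one_div_mul_log_le_log_log_sub {x : ℝ} (hx : 1 < x) :
    1 / ((x + 1) * Real.log (x + 1)) ≤ Real.log (Real.log (x + 1)) - Real.log (Real.log x) := by
  have h0 : 0 < Real.log x := Real.log_pos hx
  have h1 : 0 < Real.log (x + 1) := Real.log_pos (by linarith)
  have hratio := Real.one_sub_inv_le_log_of_pos (div_pos h1 h0)
  rw [Real.log_div h1.ne' h0.ne', inv_div] at hratio
  have hx1 : 0 < x + 1 := by linarith
  have hdiff := Real.one_sub_inv_le_log_of_pos (div_pos hx1 (by linarith : 0 < x))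
  rw [Real.log_div hx1.ne' (by linarith), inv_div] at hdiff
  refine le_trans ?_ hratio
  calc 1 / ((x + 1) * Real.log (x + 1)) = (1 - x / (x + 1)) / Real.log (x + 1) := by
        field_simp
        ring
    _ ≤ (Real.log (x + 1) - Real.log x) / Real.log (x + 1) := by gcongr
    _ = 1 - Real.log x / Real.log (x + 1) := by field_simp

theorem sum_range_sixteen_one_div_nth_prime_lt_two :
    ∑ j ∈ Finset.range 16, (1 : ℝ) / Nat.nth Nat.Prime j < 2 := by
  have h5 : Nat.nth Nat.Prime 5 = 13 := Nat.nth_count (by norm_num : Nat.Prime 13)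
  have h6 : Nat.nth Nat.Prime 6 = 17 := Nat.nth_count (by norm_num : Nat.Prime 17)
  have hge : ∀ j ∈ Finset.Ico 7 16, (1 : ℝ) / Nat.nth Nat.Prime j ≤ 1 / 17 := by
    intro j hj
    have h : 17 ≤ Nat.nth Nat.Prime j :=
      h6 ▸ Nat.nth_monotone Nat.infinite_setOfPred_prime (by have := Finset.mem_Ico.1 hj; omega)
    have h' : (17 : ℝ) ≤ Nat.nth Nat.Prime j := by exact_mod_cast h
    gcongr
  have htail := Finset.sum_le_card_nsmul _ _ _ hge
  rw [← Finset.sum_range_add_sum_Ico _ (by norm_num : 7 ≤ 16)]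
  simp only [Finset.sum_range_succ, Finset.sum_range_zero, Nat.nth_prime_zero_eq_two,
    Nat.nth_prime_one_eq_three, Nat.nth_prime_two_eq_five, Nat.nth_prime_three_eq_seven,
    Nat.nth_prime_four_eq_eleven, h5, h6]
  norm_num at htail ⊢
  linarith

theorem one_lt_log_log_sixteen : 1 < Real.log (Real.log 16) := by
  have h : Real.log 16 = 4 * Real.log 2 := by
    rw [show (16 : ℝ) = 2 ^ 4 by norm_num, Real.log_pow]
    norm_num
  have hlog2 := Real.log_two_gt_d9
  rw [Real.lt_log_iff_exp_lt (by linarith)]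
  linarith [Real.exp_one_lt_d9]

/-- For every `r ≥ 16`, the sum of reciprocals of the first `r` primes is less
than `2 ln(ln r)`. -/
theorem prime_reciprocal_sum_bound (r : ℕ) (hr : 16 ≤ r) :
    ∑ j ∈ Finset.Icc 1 r, (1 : ℝ) / (Nat.nth Nat.Prime (j - 1))
      < 2 * Real.log (Real.log r) := by
  have hshift (m : ℕ) : ∑ j ∈ Finset.Icc 1 m, (1 : ℝ) / (Nat.nth Nat.Prime (j - 1)) =
      ∑ j ∈ Finset.range m, (1 : ℝ) / Nat.nth Nat.Prime j := by
    induction m with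
    | zero => simp
    | succ m ih =>
      rw [Finset.sum_Icc_succ_top (by omega), Finset.sum_range_succ, ih, Nat.add_sub_cancel]
  rw [hshift]
  induction r, hr using Nat.le_induction with
  | base =>
    push_cast
    linarith [sum_range_sixteen_one_div_nth_prime_lt_two, one_lt_log_log_sixteen]
  | succ n hn ih =>
    have hn' : (16 : ℝ) ≤ n := by exact_mod_cast hn
    have hlog : 0 < Real.log (n + 1) := Real.log_pos (by linarith)
    have hstep := Real.one_div_mul_log_le_log_log_sub (x := n) (by linarith)
    have hterm : (1 : ℝ) / Nat.nth Nat.Prime n ≤ 2 * (1 / ((n + 1) * Real.log (n + 1))) := by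
      have hq : (0 : ℝ) < Nat.nth Nat.Prime n := by
        exact_mod_cast (Nat.prime_nth_prime n).pos
      rw [mul_one_div, div_le_div_iff₀ hq (by positivity), one_mul]
      exact mul_log_le_two_mul_nth_prime hn
    rw [Finset.sum_range_succ]
    push_cast
    linarith
end
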